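/- arXiv:2101.06601 — 6 statements merged into one kernel-verified Lean document; each statement's English description precedes it below -/
import Mathlib

section
/- Let Δn be a positive integer and let β be a nonzero real number with β ≠ 1/(1+N²) for every integer N > 1, satisfying max(3/(5Δn²), 1/(1+Δn²)) < β < min(6/(5Δn²), 1/((Δn/2)²+1)) if Δn < 3, and 1/(1+Δn²) < β < 1/(1+(Δn/2)²) if Δn ≥ 3. Suppose μ₀ ∈ [0, 1/2] and integers m, n with m = n + Δn satisfy Ω(μ₀+m) = Ω(μ₀+n) and Ω′(μ₀+m) = Ω′(μ₀+n), where Ω′ denotes the derivative of Ω. Then Δn = 2 and μ₀ = 0. -/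
/-- The Kawahara dispersion relation in the traveling frame:
`Ω(k) = -c₀ k + k³ - β k⁵` with `c₀ = 1 - β`. -/
def Ω (β k : ℝ) : ℝ := -((1 - β) * k) + k ^ 3 - β * k ^ 5

theorem hasDerivAt_Ω (β k : ℝ) :
    HasDerivAt (Ω β) (-(1 - β) + 3 * k ^ 2 - 5 * β * k ^ 4) k := by
  have h := ((((hasDerivAt_id k).const_mul (1 - β)).neg.add (hasDerivAt_pow 3 k)).sub
    ((hasDerivAt_pow 5 k).const_mul β))
  refine h.congr_deriv ?_
  norm_num
  ring

/-- Equal group velocities at `a` and `b` force `a = -b`, `a = b` or `5β(a² + b²) = 3`. -/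
theorem deriv_Ω_eq_iff (β a b : ℝ) :
    deriv (Ω β) a = deriv (Ω β) b ↔
      (a - b) * (a + b) = 0 ∨ 5 * β * (a ^ 2 + b ^ 2) = 3 := by
  rw [(hasDerivAt_Ω β a).deriv, (hasDerivAt_Ω β b).deriv, ← sub_eq_zero,
    ← sub_eq_zero (b := (3 : ℝ)), ← mul_eq_zero]
  constructor <;> intro h <;> linear_combination -h

/-- The collision condition for distinct wave numbers, divided by their difference. -/
theorem collision_quotient {β a b : ℝ} (hab : a - b ≠ 0) (h : Ω β a = Ω β b) :
    -(1 - β) + (a ^ 2 + a * b + b ^ 2) -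
      β * (a ^ 4 + a ^ 3 * b + a ^ 2 * b ^ 2 + a * b ^ 3 + b ^ 4) = 0 := by
  unfold Ω at h
  apply mul_left_cancel₀ hab
  linear_combination h

/-- A collision with equal group velocities off the symmetric configuration satisfies a quadratic
equation in `a² + b²`. -/
theorem collision_quadratic {β a b : ℝ}
    (hcol : -(1 - β) + (a ^ 2 + a * b + b ^ 2) -
      β * (a ^ 4 + a ^ 3 * b + a ^ 2 * b ^ 2 + a * b ^ 3 + b ^ 4) = 0)
    (hcg : 5 * β * (a ^ 2 + b ^ 2) = 3) :
    15 * (a ^ 2 + b ^ 2) ^ 2 - 10 * (a ^ 2 + b ^ 2) * (a - b) ^ 2 + 3 * ((a - b) ^ 2) ^ 2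
      - 20 * (a ^ 2 + b ^ 2) + 12 = 0 := by
  linear_combination 20 * (a ^ 2 + b ^ 2) * hcol + 4 * (a ^ 4 + a ^ 3 * b + a ^ 2 * b ^ 2 +
    a * b ^ 3 + b ^ 4 - 1) * hcg

/-- **Corollary 1.** If, in addition to the collision condition `Ω(μ₀+m) = Ω(μ₀+n)`, the
group velocities coincide, `Ω′(μ₀+m) = Ω′(μ₀+n)`, then `Δn = 2` and `μ₀ = 0`. -/
theorem collision_equal_group_velocity (Δn : ℕ) (hΔn : 0 < Δn) (β : ℝ) (hβ0 : β ≠ 0)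
    (hres : ∀ N : ℤ, 1 < N → β ≠ 1 / (1 + (N : ℝ) ^ 2))
    (hineq : if Δn < 3 then
        max (3 / (5 * (Δn : ℝ) ^ 2)) (1 / (1 + (Δn : ℝ) ^ 2)) < β ∧
          β < min (6 / (5 * (Δn : ℝ) ^ 2)) (1 / (((Δn : ℝ) / 2) ^ 2 + 1))
      else
        1 / (1 + (Δn : ℝ) ^ 2) < β ∧ β < 1 / (1 + ((Δn : ℝ) / 2) ^ 2))
    (μ₀ : ℝ) (hμ₀ : μ₀ ∈ Set.Icc (0 : ℝ) (1 / 2)) (m n : ℤ) (hmn : m = n + (Δn : ℤ))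
    (hcol : Ω β (μ₀ + m) = Ω β (μ₀ + n))
    (hcg : deriv (Ω β) (μ₀ + m) = deriv (Ω β) (μ₀ + n)) :
    Δn = 2 ∧ μ₀ = 0 := by
  have hd : (0 : ℝ) < Δn := by exact_mod_cast hΔn
  obtain ⟨a, ha⟩ : ∃ a : ℝ, a = μ₀ + m := ⟨_, rfl⟩
  obtain ⟨b, hb⟩ : ∃ b : ℝ, b = μ₀ + n := ⟨_, rfl⟩
  rw [← ha, ← hb] at hcol hcg
  have hab : a - b = Δn := by rw [ha, hb, hmn]; push_cast; ring
  have hquot := collision_quotient (hab ▸ hd.ne') hcol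
  have hupper : β < 1 / (1 + ((Δn : ℝ) / 2) ^ 2) := by
    split_ifs at hineq
    · rw [add_comm]
      exact hineq.2.trans_le (min_le_right _ _)
    · exact hineq.2
  rw [lt_div_iff₀ (by positivity)] at hupper
  rcases (deriv_Ω_eq_iff β a b).1 hcg with h | h
  · have hsum : a + b = 0 := (mul_eq_zero.1 h).resolve_left (hab ▸ hd.ne')
    have ha2 : a = Δn / 2 := by linarith
    have hb2 : b = -(Δn / 2) := by linarith
    have hfac : (((Δn : ℝ) / 2) ^ 2 - 1) * (1 - β * (1 + ((Δn : ℝ) / 2) ^ 2)) = 0 := by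
      rw [ha2, hb2] at hquot
      linear_combination hquot
    have hone := (mul_eq_zero.1 hfac).resolve_right (by linarith)
    have htwo : (Δn : ℝ) = 2 := by nlinarith
    have hΔ : Δn = 2 := by exact_mod_cast htwo
    refine ⟨hΔ, ?_⟩
    have hμ : μ₀ = ((-n - 1 : ℤ) : ℝ) := by push_cast; linarith
    obtain ⟨h0, h1⟩ := hμ₀
    rw [hμ] at h0 h1 ⊢
    have h0' : 0 ≤ -n - 1 := by exact_mod_cast h0
    have h1' : -n - 1 < 1 := by
      have : ((-n - 1 : ℤ) : ℝ) < 1 := by linarith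
      exact_mod_cast this
    have : -n - 1 = 0 := by omega
    rw [this, Int.cast_zero]
  · exfalso
    have hquad := collision_quadratic hquot h
    rw [hab] at hquad
    generalize a ^ 2 + b ^ 2 = A at h hquad
    by_cases hlt : Δn < 3
    · rw [if_pos hlt] at hineq
      have hlo := (le_max_left _ _).trans_lt hineq.1
      have hhi := hineq.2.trans_le (min_le_left _ _)
      interval_cases Δn
      · have hA : A = 1 := by
          have : (A - 1) ^ 2 = 0 := by push_cast at hquad; linear_combination hquad / 15
          linarith [pow_eq_zero_iff two_ne_zero |>.1 this]
        subst hA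
        norm_num at hlo
        linarith
      · have hA : A = 2 := by
          have : (A - 2) ^ 2 = 0 := by push_cast at hquad; linear_combination hquad / 15
          linarith [pow_eq_zero_iff two_ne_zero |>.1 this]
        subst hA
        norm_num at hhi
        linarith
    · have h3 : (3 : ℝ) ≤ Δn := by exact_mod_cast not_lt.1 hlt
      have h9 : (9 : ℝ) ≤ (Δn : ℝ) ^ 2 := by nlinarith
      nlinarith [sq_nonneg (15 * A - 5 * (Δn : ℝ) ^ 2 - 10),
        mul_nonneg (sub_nonneg.2 h9) (sub_nonneg.2 h9)]
end

section
/- Let β be a real number with 1/5 < β < 3/10, let σ be a nonzero real number, and set k = −1 + √(3/(5β) − 2). Then Ω(2) ≠ 0, Ω(k+1) − Ω(k) ≠ 0, and σ²·[ (k+1)/(Ω(k+1) − Ω(k)) + 1/Ω(2) ] = σ²/(2(1 − 5β)); in particular this quantity is nonzero. -/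
theorem Ω_two (β : ℝ) : Ω β 2 = 6 * (1 - 5 * β) := by
  unfold Ω
  ring

/-- On the curve `β (s² + 2) = 3/5` the frequency difference factors. -/
theorem Ω_sub_Ω_sub_one {β s : ℝ} (h : 5 * β * (s ^ 2 + 2) = 3) :
    Ω β s - Ω β (s - 1) = 3 * s * (1 - 5 * β) := by
  unfold Ω
  linear_combination (-s * (s - 2)) * h

/-- **Corollary 2.** For `1/5 < β < 3/10`, `σ ≠ 0`, and `k = -1 + √(3/(5β) - 2)`, the
quantity `𝒮₂ = σ²[(k+1)/(Ω(k+1) - Ω(k)) + 1/Ω(2)]` equals `σ²/(2(1 - 5β))` and is nonzero. -/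
theorem S2_nonzero (β σ : ℝ) (hβ₁ : 1 / 5 < β) (hβ₂ : β < 3 / 10) (hσ : σ ≠ 0)
    (k : ℝ) (hk : k = -1 + Real.sqrt (3 / (5 * β) - 2)) :
    Ω β 2 ≠ 0 ∧ Ω β (k + 1) - Ω β k ≠ 0 ∧
      σ ^ 2 * ((k + 1) / (Ω β (k + 1) - Ω β k) + 1 / Ω β 2) = σ ^ 2 / (2 * (1 - 5 * β)) ∧
      σ ^ 2 / (2 * (1 - 5 * β)) ≠ 0 := by
  obtain ⟨s, hs⟩ : ∃ s, s = Real.sqrt (3 / (5 * β) - 2) := ⟨_, rfl⟩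
  have hβ : 0 < β := by linarith
  have hrad : 0 < 3 / (5 * β) - 2 := by
    rw [sub_pos, lt_div_iff₀ (by positivity)]
    linarith
  have hs_pos : 0 < s := hs ▸ Real.sqrt_pos.mpr hrad
  have hcurve : 5 * β * (s ^ 2 + 2) = 3 := by
    rw [hs, Real.sq_sqrt hrad.le]
    field_simp
    ring
  have hβ_ne : 1 - 5 * β ≠ 0 := ne_of_lt (by linarith)
  obtain rfl : k = s - 1 := by rw [hk, hs]; ring
  rw [sub_add_cancel, Ω_sub_Ω_sub_one hcurve, Ω_two]
  refine ⟨by positivity, by positivity, ?_, by positivity⟩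
  field_simp
  norm_num
end

section
/- Let β be a real number with 1/5 < β < 3/10 and define F(k) = (Ω(k+2) − Ω(k))/2, a quartic polynomial in k. Then k = −1 is a double root of F, i.e. F(−1) = 0 and F′(−1) = 0; the remaining real roots of F are k = −1 + √(3/(5β) − 2) and k = −1 − √(3/(5β) − 2); and −1 + √(3/(5β) − 2) lies in the open interval (−1, 0). -/
/-- Centred at `k = -1`, the collision function for `Δn = 2` is an even quartic without
constant term. -/
theorem half_Ω_add_two_sub (β k : ℝ) :
    (Ω β (k + 2) - Ω β k) / 2 = (k + 1) ^ 2 * (3 - 10 * β - 5 * β * (k + 1) ^ 2) := by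
  unfold Ω
  ring

/-- For `1/5 < β < 3/10` and `F(k) = (Ω(k+2) - Ω(k))/2`, `k = -1` is a double root of `F`,
the remaining real roots are `k = -1 ± √(3/(5β) - 2)`, and `-1 + √(3/(5β) - 2) ∈ (-1, 0)`. -/
theorem delta_n_two_collision_roots (β : ℝ) (hβ₁ : 1 / 5 < β) (hβ₂ : β < 3 / 10)
    (F : ℝ → ℝ) (hF : F = fun k => (Ω β (k + 2) - Ω β k) / 2) :
    F (-1) = 0 ∧ deriv F (-1) = 0 ∧
    (∀ k : ℝ, F k = 0 ↔
      k = -1 ∨ k = -1 + Real.sqrt (3 / (5 * β) - 2) ∨ k = -1 - Real.sqrt (3 / (5 * β) - 2)) ∧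
    -1 + Real.sqrt (3 / (5 * β) - 2) ∈ Set.Ioo (-1 : ℝ) 0 := by
  have hβ : 0 < β := by linarith
  have hF' : F = fun k => (k + 1) ^ 2 * (3 - 10 * β - 5 * β * (k + 1) ^ 2) := by
    simp only [hF, half_Ω_add_two_sub]
  have hs_pos : 0 < 3 / (5 * β) - 2 := by
    rw [sub_pos, lt_div_iff₀ (by positivity)]
    linarith
  have hs_lt : 3 / (5 * β) - 2 < 1 := by
    rw [sub_lt_iff_lt_add, div_lt_iff₀ (by positivity)]
    linarith
  have hs : 5 * β * (3 / (5 * β) - 2) = 3 - 10 * β := by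
    field_simp
    ring
  clear hF
  subst hF'
  generalize 3 / (5 * β) - 2 = s at *
  have hsq : √s ^ 2 = s := Real.sq_sqrt hs_pos.le
  refine ⟨by norm_num, ?_, fun k => ?_, ?_, ?_⟩
  · have hu : HasDerivAt (fun k : ℝ => (k + 1) ^ 2) 0 (-1) := by
      simpa using ((hasDerivAt_id (-1 : ℝ)).add_const 1).fun_pow 2
    simpa using (hu.fun_mul ((hu.const_mul (5 * β)).const_sub (3 - 10 * β))).deriv
  · have factored : (k + 1) ^ 2 * (3 - 10 * β - 5 * β * (k + 1) ^ 2) =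
        -(5 * β) * ((k + 1) ^ 2 * ((k - (-1 + √s)) * (k - (-1 - √s)))) := by
      linear_combination -(k + 1) ^ 2 * hs - 5 * β * (k + 1) ^ 2 * hsq
    simp only [factored, mul_eq_zero, neg_eq_zero, OfNat.ofNat_ne_zero, hβ.ne', or_self,
      false_or, pow_eq_zero_iff, ne_eq, not_false_eq_true, sub_eq_zero, add_eq_zero_iff_eq_neg]
  · linarith [Real.sqrt_pos.mpr hs_pos]
  · have : √s < 1 := (Real.sqrt_lt' one_pos).mpr (by simpa using hs_lt)
    linarith
end

section
/- Let Δn ≥ 3 be an integer and let β be a real number with 1/(1+Δn²) < β < 1/(1+(Δn/2)²). Then the equation Ω(k+Δn) = Ω(k) has exactly two real solutions; these two solutions are distinct and both are nonpositive. -/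
/-- A real quadratic with positive leading coefficient, negative constant term and positive value
at `u > 0` has a root in `(0, u)`, and this is its only nonnegative root. -/
lemma exists_unique_nonneg_root_quadratic {A B C u : ℝ} (hA : 0 < A) (hC : C < 0) (hu : 0 < u)
    (hval : 0 < A * u ^ 2 + B * u + C) :
    ∃ y, 0 < y ∧ y < u ∧ A * y ^ 2 + B * y + C = 0 ∧
      ∀ z, 0 ≤ z → A * z ^ 2 + B * z + C = 0 → z = y := by
  have hcont : ContinuousOn (fun y : ℝ => A * y ^ 2 + B * y + C) (Set.Icc 0 u) := by fun_prop
  obtain ⟨y, ⟨hy₀, hyu⟩, hy⟩ := intermediate_value_Ioo hu.le hcont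
    (show (0 : ℝ) ∈ Set.Ioo _ _ from ⟨by simpa using hC, hval⟩)
  refine ⟨y, hy₀, hyu, hy, fun z hz hqz => ?_⟩
  dsimp only at hy
  have hpos : 0 < A * y + B := by
    by_contra! h
    nlinarith [mul_nonpos_of_nonneg_of_nonpos hy₀.le h]
  have hfac : (z - y) * (A * z + (A * y + B)) = 0 := by linear_combination hqz - hy
  rcases mul_eq_zero.mp hfac with h | h
  · linarith
  · nlinarith [mul_nonneg hA.le hz]

/-- In the variable centred at the midpoint of `k` and `k + 2a`, the collision condition is a
quadratic equation for the square. -/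
lemma collision_iff_quadratic {a : ℝ} (ha : a ≠ 0) (β k : ℝ) :
    Ω β (k + 2 * a) = Ω β k ↔
      5 * β * ((k + a) ^ 2) ^ 2 + (10 * β * a ^ 2 - 3) * (k + a) ^ 2 +
        (a ^ 2 - 1) * (β * (1 + a ^ 2) - 1) = 0 := by
  have h : Ω β (k + 2 * a) - Ω β k = -2 * a *
      (5 * β * ((k + a) ^ 2) ^ 2 + (10 * β * a ^ 2 - 3) * (k + a) ^ 2 +
        (a ^ 2 - 1) * (β * (1 + a ^ 2) - 1)) := by
    unfold Ω
    ring
  rw [← sub_eq_zero, h, mul_eq_zero_iff_left (mul_ne_zero (by norm_num) ha)]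

/-- For `Δn ≥ 3` and `1/(1+Δn²) < β < 1/(1+(Δn/2)²)`, the collision condition
`Ω(k+Δn) = Ω(k)` has exactly two real solutions; they are distinct and nonpositive. -/
theorem delta_n_ge_three_collision_roots (Δn : ℕ) (hΔn : 3 ≤ Δn) (β : ℝ)
    (hβ₁ : 1 / (1 + (Δn : ℝ) ^ 2) < β) (hβ₂ : β < 1 / (1 + ((Δn : ℝ) / 2) ^ 2)) :
    ∃ k₁ k₂ : ℝ, k₁ ≠ k₂ ∧ k₁ ≤ 0 ∧ k₂ ≤ 0 ∧
      {k : ℝ | Ω β (k + (Δn : ℝ)) = Ω β k} = {k₁, k₂} := by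
  have hn : (3 : ℝ) ≤ Δn := by exact_mod_cast hΔn
  obtain ⟨a, ha⟩ : ∃ a : ℝ, (Δn : ℝ) = 2 * a := ⟨Δn / 2, by ring⟩
  rw [ha] at hn hβ₁ hβ₂ ⊢
  rw [mul_div_cancel_left₀ a two_ne_zero, lt_div_iff₀ (by positivity)] at hβ₂
  have hβ : 0 < β := lt_trans (by positivity) hβ₁
  rw [div_lt_iff₀ (by positivity)] at hβ₁
  have ha₀ : 0 < a := by linarith
  have ha₁ : 1 < a ^ 2 := by nlinarith
  have hconst : (a ^ 2 - 1) * (β * (1 + a ^ 2) - 1) < 0 :=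
    mul_neg_of_pos_of_neg (by linarith) (by linarith)
  have hval : 0 < 5 * β * (a ^ 2) ^ 2 + (10 * β * a ^ 2 - 3) * a ^ 2 +
      (a ^ 2 - 1) * (β * (1 + a ^ 2) - 1) := by
    have h : 0 < (4 * a ^ 2 - 1) * (β * (1 + (2 * a) ^ 2) - 1) :=
      mul_pos (by linarith) (by linarith)
    linear_combination h
  obtain ⟨y, hy₀, hya, hy, huniq⟩ :=
    exists_unique_nonneg_root_quadratic (by positivity) hconst (by positivity) hval
  have hs : 0 < √y := Real.sqrt_pos.mpr hy₀
  have hsq : √y ^ 2 = y := Real.sq_sqrt hy₀.le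
  have hsa : √y < a := (Real.sqrt_lt' ha₀).mpr hya
  refine ⟨-a - √y, -a + √y, by linarith, by linarith, by linarith, ?_⟩
  ext k
  simp only [Set.mem_ofPred_eq, Set.mem_insert_iff, Set.mem_singleton_iff,
    collision_iff_quadratic ha₀.ne']
  constructor
  · intro hk
    have hky : (k + a) ^ 2 = √y ^ 2 := by rw [hsq, huniq _ (sq_nonneg _) hk]
    rcases sq_eq_sq_iff_eq_or_eq_neg.mp hky with h | h
    · right; linarith
    · left; linarith
  · intro hk
    have hky : (k + a) ^ 2 = y := by
      rw [← hsq]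
      rcases hk with rfl | rfl <;> ring
    rw [hky, hy]
end

section
/- Let Δn ≥ 3 be an integer and let β be a real number with 1/(1+Δn²) < β < 1/(1+(Δn/2)²). Then 5β·(Δn² − 4)·(β(Δn² + 4) − 4)·(5β(β(Δn⁴ + 4) − 2(Δn² + 2)) + 9)² < 0. (This quantity is the discriminant in k of the quartic polynomial F(k; Δn) = (Ω(k+Δn) − Ω(k))/Δn.) -/
/-- For `Δn ≥ 3` and `1/(1+Δn²) < β < 1/(1+(Δn/2)²)`, the discriminant in `k` of the
quartic `F(k; Δn) = (Ω(k+Δn) - Ω(k))/Δn` is negative: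
`5β(Δn² - 4)(β(Δn² + 4) - 4)(5β(β(Δn⁴ + 4) - 2(Δn² + 2)) + 9)² < 0`. -/
theorem discriminant_negative (Δn : ℕ) (hΔn : 3 ≤ Δn) (β : ℝ)
    (hβ₁ : 1 / (1 + (Δn : ℝ) ^ 2) < β) (hβ₂ : β < 1 / (1 + ((Δn : ℝ) / 2) ^ 2)) :
    5 * β * ((Δn : ℝ) ^ 2 - 4) * (β * ((Δn : ℝ) ^ 2 + 4) - 4) *
      (5 * β * (β * ((Δn : ℝ) ^ 4 + 4) - 2 * ((Δn : ℝ) ^ 2 + 2)) + 9) ^ 2 < 0 := by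
  have hn : (3 : ℝ) ≤ Δn := by exact_mod_cast hΔn
  have hm : (9 : ℝ) ≤ (Δn : ℝ) ^ 2 := by nlinarith
  have hβ : 0 < β := lt_trans (by positivity) hβ₁
  have hlin : β * ((Δn : ℝ) ^ 2 + 4) - 4 < 0 := by
    rw [lt_div_iff₀ (by positivity)] at hβ₂
    linarith
  have hquad : 0 < 5 * β * (β * ((Δn : ℝ) ^ 4 + 4) - 2 * ((Δn : ℝ) ^ 2 + 2)) + 9 := by
    have hlead : 0 < 5 * ((Δn : ℝ) ^ 4 + 4) := by positivity
    refine pos_of_mul_pos_right ?_ hlead.le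
    have hdisc : 0 < ((Δn : ℝ) ^ 2 - 1) * ((Δn : ℝ) ^ 2 - 4) :=
      mul_pos (by linarith) (by linarith)
    linarith [sq_nonneg (5 * ((Δn : ℝ) ^ 4 + 4) * β - 5 * ((Δn : ℝ) ^ 2 + 2))]
  exact mul_neg_of_neg_of_pos
    (mul_neg_of_pos_of_neg (mul_pos (by positivity) (by linarith)) hlin) (by positivity)
end

section
/- Let a, b, cₙ, c_m, μ₁, σ be real numbers such that R := −μ₁²((c_m − cₙ)/2)² − σ²ab > 0. Define the complex numbers λ₁ = √R − iμ₁(c_m + cₙ)/2 and γ₀ = iσb/(λ₁ + iμ₁c_m) (the denominator λ₁ + iμ₁c_m = √R + iμ₁(c_m − cₙ)/2 is nonzero). Then λ₁ and γ₀ solve the solvability system λ₁ + iμ₁cₙ − iσγ₀a = 0 and γ₀(λ₁ + iμ₁c_m) − iσb = 0; equivalently (λ₁ + iμ₁cₙ)(λ₁ + iμ₁c_m) = −σ²ab. -/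
open Complex

/-- The first-order corrections `λ₁ = √R - iμ₁(c_m + cₙ)/2` and
`γ₀ = iσb/(λ₁ + iμ₁c_m)` solve the `O(ε)` solvability system of the `Δn = 1`
high-frequency instability, and `(λ₁ + iμ₁cₙ)(λ₁ + iμ₁c_m) = -σ²ab`. -/
theorem first_order_solvability (a b cn cm μ₁ σ : ℝ)
    (R : ℝ) (hR : R = -μ₁ ^ 2 * ((cm - cn) / 2) ^ 2 - σ ^ 2 * a * b) (hRpos : 0 < R)
    (lam₁ : ℂ) (hlam : lam₁ = (Real.sqrt R : ℂ) - I * μ₁ * (cm + cn) / 2)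
    (γ₀ : ℂ) (hγ : γ₀ = I * σ * b / (lam₁ + I * μ₁ * cm)) :
    lam₁ + I * μ₁ * cm ≠ 0 ∧
    lam₁ + I * μ₁ * cn - I * σ * γ₀ * a = 0 ∧
    γ₀ * (lam₁ + I * μ₁ * cm) - I * σ * b = 0 ∧
    (lam₁ + I * μ₁ * cn) * (lam₁ + I * μ₁ * cm) = -(σ : ℂ) ^ 2 * a * b := by
  have hsq : (Real.sqrt R : ℂ) ^ 2 = -μ₁ ^ 2 * ((cm - cn) / 2) ^ 2 - σ ^ 2 * a * b := by
    rw [← ofReal_pow, Real.sq_sqrt hRpos.le, hR]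
    push_cast
    ring
  have hne : lam₁ + I * μ₁ * cm ≠ 0 := by
    intro h
    have hcast : lam₁ + I * μ₁ * cm = (Real.sqrt R : ℂ) + (μ₁ * (cm - cn) / 2 : ℝ) * I := by
      rw [hlam]
      push_cast
      ring
    have hre := congrArg re (hcast.symm.trans h)
    simp only [add_re, ofReal_re, re_ofReal_mul, I_re, mul_zero, add_zero, zero_re] at hre
    exact (Real.sqrt_pos.mpr hRpos).ne' hre
  have hprod : (lam₁ + I * μ₁ * cn) * (lam₁ + I * μ₁ * cm) = -(σ : ℂ) ^ 2 * a * b := by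
    rw [hlam]
    linear_combination hsq - (μ₁ : ℂ) ^ 2 * ((cm - cn) / 2) ^ 2 * I_sq
  have hγmul : γ₀ * (lam₁ + I * μ₁ * cm) = I * σ * b := by
    rw [hγ, div_mul_cancel₀ _ hne]
  refine ⟨hne, mul_right_cancel₀ hne ?_, sub_eq_zero.mpr hγmul, hprod⟩
  linear_combination hprod - I * σ * a * hγmul - (σ : ℂ) ^ 2 * a * b * I_sq
end
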